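/- Let d ≥ 2 and k, n be integers with 1 ≤ k − 1 ≤ n ≤ d. There exists C > 0 such that the following holds for every odd prime power q. Let Q be a nondegenerate quadratic form on 𝔽_q^d, let H be a graph on vertex set {1, …, k} with exactly n edges, and let c assign to each edge of H a color in 𝔽_q* = 𝔽_q \ {0}. Then every set E ⊆ 𝔽_q^d with |E| ≥ C·q^{(d−1)/2 + k − 1} contains a copy of the colored graph H: there exist distinct points x₁, …, x_k ∈ E with Q(x_i − x_j) = c({i, j}) for every edge {i, j} of H. -/

import Mathlib

open Finset
open scoped Classical

section PolynomialMethod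
open Polynomial

theorem eq_zero_of_X_pow_dvd_add_mul_pow {L : Type*} [Field L] {p m r : ℕ} [Fact p.Prime] [CharP L p]
    (hs : p ^ m = 2 * r + 1) {f A D : L[X]} (hf0 : f.coeff 0 ≠ 0)
    (hsq : ∀ (A D : L[X]) (c : L), c ≠ 0 → A ^ 2 = C c * D ^ 2 * f → D = 0)
    (hA : 2 * A.natDegree < p ^ m) (hD : 2 * D.natDegree + f.natDegree < p ^ m)
    (h : X ^ p ^ m ∣ A + D * f ^ (r + 1)) : A = 0 ∧ D = 0 := by
  have hfs : f ^ p ^ m = X ^ p ^ m * f.divX ^ p ^ m + C (f.coeff 0 ^ p ^ m) := by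
    conv_lhs => rw [← X_mul_divX_add f]
    rw [add_pow_char_pow, mul_pow, C_pow]
  have h2 : X ^ p ^ m ∣ A ^ 2 - C (f.coeff 0 ^ p ^ m) * D ^ 2 * f := by
    have h3 : A ^ 2 - C (f.coeff 0 ^ p ^ m) * D ^ 2 * f
        = (A + D * f ^ (r + 1)) * (A - D * f ^ (r + 1)) + X ^ p ^ m * (f.divX ^ p ^ m * D ^ 2 * f) := by
      have h4 : (f ^ (r + 1)) ^ 2 = f ^ p ^ m * f := by rw [hs]; ring
      have h5 : (A + D * f ^ (r + 1)) * (A - D * f ^ (r + 1)) = A ^ 2 - D ^ 2 * (f ^ (r + 1)) ^ 2 := by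
        ring
      rw [h5, h4, hfs]; ring
    rw [h3]
    exact dvd_add (h.mul_right _) (dvd_mul_right _ _)
  have hdeg : (A ^ 2 - C (f.coeff 0 ^ p ^ m) * D ^ 2 * f).natDegree < p ^ m := by
    refine (natDegree_sub_le _ _).trans_lt (max_lt ?_ ?_)
    · exact natDegree_pow_le.trans_lt hA
    · refine lt_of_le_of_lt (natDegree_mul_le.trans (Nat.add_le_add_right ?_ _)) hD
      exact (natDegree_C_mul_le _ _).trans natDegree_pow_le
  have h0 := eq_zero_of_dvd_of_natDegree_lt h2 (by simpa using hdeg)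
  have hD0 : D = 0 := hsq A D _ (pow_ne_zero _ hf0) (sub_eq_zero.mp h0)
  refine ⟨?_, hD0⟩
  rw [hD0] at h0
  simpa using h0

theorem eq_zero_of_sum_mul_X_pow_eq_zero {L : Type*} [Field L] {p m r : ℕ} [Fact p.Prime] [CharP L p]
    (hs : p ^ m = 2 * r + 1) {f : L[X]} (hf0 : f.coeff 0 ≠ 0)
    (hsq : ∀ (A D : L[X]) (c : L), c ≠ 0 → A ^ 2 = C c * D ^ 2 * f → D = 0) (J : ℕ) :
    ∀ A D : Fin J → L[X], (∀ j, 2 * (A j).natDegree < p ^ m) →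
    (∀ j, 2 * (D j).natDegree + f.natDegree < p ^ m) →
    ∑ j, (A j + D j * f ^ (r + 1)) * X ^ (p ^ m * (j : ℕ)) = 0 → A = 0 ∧ D = 0 := by
  induction J with
  | zero => exact fun A D _ _ _ => ⟨Subsingleton.elim _ _, Subsingleton.elim _ _⟩
  | succ J ih =>
    intro A D hA hD h
    have hsplit : ∑ j : Fin J, (A j.succ + D j.succ * f ^ (r + 1)) * X ^ (p ^ m * (j.succ : ℕ))
        = X ^ p ^ m * ∑ j : Fin J, (A j.succ + D j.succ * f ^ (r + 1)) * X ^ (p ^ m * (j : ℕ)) := by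
      rw [mul_sum]
      refine sum_congr rfl fun j _ => ?_
      rw [Fin.val_succ, mul_add, mul_one, pow_add]; ring
    rw [Fin.sum_univ_succ, hsplit] at h
    simp only [Fin.val_zero, mul_zero, pow_zero, mul_one] at h
    obtain ⟨hA0, hD0⟩ := eq_zero_of_X_pow_dvd_add_mul_pow hs hf0 hsq (hA 0) (hD 0)
      ⟨-_, by rw [mul_neg]; exact eq_neg_of_add_eq_zero_left h⟩
    rw [hA0, hD0, zero_mul, add_zero, zero_add] at h
    obtain ⟨hA', hD'⟩ := ih (fun j => A j.succ) (fun j => D j.succ) (fun j => hA _) (fun j => hD _)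
      ((mul_eq_zero.mp h).resolve_left (pow_ne_zero _ X_ne_zero))
    constructor
    · funext j
      refine Fin.cases hA0 (fun i => congrFun hA' i) j
    · funext j
      refine Fin.cases hD0 (fun i => congrFun hD' i) j

theorem exists_frobenius_syzygy {L : Type*} [Field L] [Fintype L] {p m e b J E : ℕ} [Fact p.Prime]
    [CharP L p] {h : L[X]} (hh : h.natDegree ≤ e) (hE : p ^ m * b + e + J ≤ E)
    (hJ : E < 2 * (b + 1) * J) :
    ∃ A D : Fin J → L[X], ¬ (A = 0 ∧ D = 0) ∧ (∀ j, (A j).natDegree ≤ b) ∧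
      (∀ j, (D j).natDegree ≤ b) ∧
      ∑ j, (A j ^ p ^ m + D j ^ p ^ m * h) * X ^ (j : ℕ) = 0 := by
  let pol : (Fin (b + 1) → L) → L[X] := fun v => ((degreeLTEquiv L (b + 1)).symm v : L[X])
  have pol_sub (u v) : pol (u - v) = pol u - pol v := by simp [pol]
  have pol_inj {u} (hu : pol u = 0) : u = 0 := by simpa [pol] using hu
  have pol_deg (u) : (pol u).natDegree ≤ b := by
    have h1 : pol u ∈ degreeLE L b :=
      (degreeLT_succ_eq_degreeLE (R := L) (n := b)).le ((degreeLTEquiv L (b + 1)).symm u).2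
    exact natDegree_le_of_degree_le (mem_degreeLE.mp h1)
  let P : (Fin J → (Fin (b + 1) → L) × (Fin (b + 1) → L)) → L[X] := fun v =>
    ∑ j, (pol (v j).1 ^ p ^ m + pol (v j).2 ^ p ^ m * h) * X ^ (j : ℕ)
  have P_sub (u v) : P (u - v) = P u - P v := by
    simp only [P, ← sum_sub_distrib]
    refine sum_congr rfl fun j _ => ?_
    simp only [Pi.sub_apply, Prod.fst_sub, Prod.snd_sub, pol_sub, sub_pow_char_pow]
    ring
  have P_deg (u) : (P u).degree < E := by
    refine (degree_sum_le _ _).trans_lt ((Finset.sup_lt_iff (WithBot.bot_lt_coe _)).2 fun j _ => ?_)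
    refine degree_le_natDegree.trans_lt (Nat.cast_lt.mpr ?_)
    refine (natDegree_mul_le.trans (Nat.add_le_add_left (natDegree_X_pow_le _) _)).trans_lt ?_
    have h1 : (pol (u j).1 ^ p ^ m + pol (u j).2 ^ p ^ m * h).natDegree ≤ p ^ m * b + e := by
      refine natDegree_add_le_of_degree_le ?_ ?_
      · exact (natDegree_pow_le_of_le _ (pol_deg _)).trans (Nat.le_add_right _ _)
      · exact natDegree_mul_le_of_le (natDegree_pow_le_of_le _ (pol_deg _)) hh
    have := j.2
    omega
  have hcard : Fintype.card (Fin E → L) <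
      Fintype.card (Fin J → (Fin (b + 1) → L) × (Fin (b + 1) → L)) := by
    simp only [Fintype.card_fun, Fintype.card_prod, Fintype.card_fin, ← pow_add, ← pow_mul]
    refine Nat.pow_lt_pow_right Fintype.one_lt_card ?_
    linarith
  obtain ⟨u, v, huv, heq⟩ := Fintype.exists_ne_map_eq_of_card_lt
    (fun u (i : Fin E) => (P u).coeff i) hcard
  have hP : P (u - v) = 0 := by
    ext i
    rw [P_sub, coeff_sub, coeff_zero, sub_eq_zero]
    by_cases hi : i < E
    · exact congrFun heq ⟨i, hi⟩
    · have hw (w) : (P w).coeff i = 0 :=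
        coeff_eq_zero_of_degree_lt ((P_deg w).trans_le (by exact_mod_cast not_lt.mp hi))
      rw [hw, hw]
  refine ⟨fun j => pol ((u - v) j).1, fun j => pol ((u - v) j).2, ?_, fun j => pol_deg _,
    fun j => pol_deg _, hP⟩
  rintro ⟨h1, h2⟩
  refine huv (sub_eq_zero.mp (funext fun j => Prod.ext ?_ ?_))
  · exact pol_inj (congrFun h1 j)
  · exact pol_inj (congrFun h2 j)

theorem card_isSquare_eval_le {L : Type*} [Field L] [Fintype L] {p m r q : ℕ} [Fact p.Prime]
    [CharP L p] (hs : p ^ m = 2 * r + 1) (hL : Fintype.card L = (p ^ m) ^ 2) (hqr : 2 * q ≤ r)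
    {f : L[X]} (hf : f.natDegree ≤ 2 * q) (hf0 : f.coeff 0 ≠ 0)
    (hsq : ∀ (A D : L[X]) (c : L), c ≠ 0 → A ^ 2 = C c * D ^ 2 * f → D = 0) :
    2 * #{y : L | IsSquare (f.eval y)} ≤ (p ^ m) ^ 2 + 6 * q * p ^ m := by
  obtain rfl | hq := Nat.eq_zero_or_pos q
  · exfalso
    have hf1 : f = C (f.coeff 0) := eq_C_of_natDegree_le_zero (by simpa using hf)
    have := hsq f f (f.coeff 0)⁻¹ (inv_ne_zero hf0) (by
      rw [hf1]; simp only [coeff_C_zero, ← C_pow, ← C_mul]; congr 1; field_simp)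
    exact hf0 (by simp [this])
  have hh : (f ^ (r + 1)).natDegree ≤ (r + 1) * (2 * q) := natDegree_pow_le_of_le _ hf
  obtain ⟨b, rfl⟩ : ∃ b, r = b + q := ⟨r - q, by omega⟩
  obtain ⟨A, D, hne, hA, hD, hAD⟩ := exists_frobenius_syzygy (p := p) (m := m) (b := b)
    (J := b + 3 * q) hh le_rfl (by rw [hs]; nlinarith)
  set Z : L[X] := ∑ j, (A j + D j * f ^ (b + q + 1)) * X ^ (p ^ m * (j : ℕ)) with hZ
  have hZ0 : Z ≠ 0 := fun h0 => hne <| eq_zero_of_sum_mul_X_pow_eq_zero hs hf0 hsq _ A D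
    (fun j => by have := hA j; omega) (fun j => by have := hD j; omega) h0
  have hZdeg : Z.natDegree ≤ b + (b + q + 1) * (2 * q) + p ^ m * (b + 3 * q - 1) := by
    refine natDegree_sum_le_of_forall_le _ _ fun j _ => ?_
    refine natDegree_mul_le_of_le (natDegree_add_le_of_degree_le ?_ ?_) ?_
    · exact (hA j).trans (Nat.le_add_right _ _)
    · exact natDegree_mul_le_of_le (hD j) hh
    · exact (natDegree_X_pow_le _).trans (Nat.mul_le_mul_left _ (by have := j.2; omega))
  have hroot : ∀ y : L, IsSquare (f.eval y) → Z.eval y = 0 := by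
    rintro y ⟨w, hw⟩
    have hy : y ^ (p ^ m * p ^ m) = y := by rw [← sq, ← hL, FiniteField.pow_card]
    have hw' : w ^ (p ^ m * p ^ m) = w := by rw [← sq, ← hL, FiniteField.pow_card]
    have hfp : (f.eval y ^ (b + q + 1)) ^ p ^ m = f.eval y ^ (b + q + 1) := by
      have : f.eval y ^ (b + q + 1) = w ^ (p ^ m + 1) := by
        rw [hw, ← sq, ← pow_mul, hs]; congr 1
      rw [this, ← pow_mul, add_mul, pow_add, hw']; ring
    have hpow : Z.eval y ^ p ^ m = 0 := by
      have h0 := congrArg (eval y) hAD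
      rw [hZ, eval_finsetSum, sum_pow_char_pow]
      rw [eval_finsetSum, eval_zero] at h0
      rw [← h0]
      refine sum_congr rfl fun j _ => ?_
      simp only [eval_mul, eval_add, eval_pow, eval_X, mul_pow, add_pow_char_pow, hfp]
      rw [← pow_mul y, mul_right_comm, pow_mul y, hy]
    exact pow_eq_zero_iff (by rw [hs]; omega) |>.mp hpow
  have hcard : #{y : L | IsSquare (f.eval y)} ≤ Z.natDegree := by
    refine le_trans (card_le_card (t := Z.roots.toFinset) fun y hy => ?_)
      ((Multiset.toFinset_card_le _).trans (card_roots' Z))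
    rw [Multiset.mem_toFinset, mem_roots hZ0]
    exact hroot y (by simpa using hy)
  have hb : b + 3 * q - 1 + 1 = b + 3 * q := by omega
  generalize b + 3 * q - 1 = c at *
  rw [hs] at hZdeg ⊢
  nlinarith

theorem natDegree_X_pow_sub_X_add_C {L : Type*} [Field L] {q : ℕ} (hq : 1 < q) (β : L) :
    (X ^ q - X + C β : L[X]).natDegree = q := by
  rw [natDegree_add_C, natDegree_sub_eq_left_of_natDegree_lt] <;> simp [hq]

theorem natDegree_sq_X_pow_sub_X_add_C_sub_C {L : Type*} [Field L] {q : ℕ} (hq : 1 < q) (β γ : L) :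
    ((X ^ q - X + C β) ^ 2 - C γ : L[X]).natDegree = 2 * q := by
  rw [natDegree_sub_C, natDegree_pow, natDegree_X_pow_sub_X_add_C hq]

theorem eq_zero_of_sq_eq_C_mul_sq_mul {L : Type*} [Field L] {q : ℕ} (hq : 1 < q) (hqL : (q : L) = 0)
    (h2 : (2 : L) ≠ 0) (β : L) {γ : L} (hγ : γ ≠ 0) (A D : L[X]) (c : L) (hc : c ≠ 0)
    (h : A ^ 2 = C c * D ^ 2 * ((X ^ q - X + C β) ^ 2 - C γ)) : D = 0 := by
  by_contra hD
  obtain ⟨B, rfl⟩ : D ∣ A := by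
    rw [← UniqueFactorizationMonoid.pow_dvd_pow_iff_dvd two_ne_zero, h]
    exact ⟨C c * ((X ^ q - X + C β) ^ 2 - C γ), by ring⟩
  have hB : B ^ 2 = C c * ((X ^ q - X + C β) ^ 2 - C γ) := by
    refine mul_left_cancel₀ (pow_ne_zero 2 hD) ?_
    rw [← mul_pow, h]; ring
  have hder : B * derivative B = - (C c * (X ^ q - X + C β)) := by
    have := congrArg derivative hB
    simp only [derivative_pow, derivative_mul, derivative_C, derivative_sub, derivative_add,
      derivative_X, hqL, C_0] at this
    refine mul_left_cancel₀ (a := C (2 : L)) (by simpa using h2) ?_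
    simp only [Nat.cast_ofNat] at this
    linear_combination this
  have hBg : B ∣ X ^ q - X + C β :=
    ⟨- (C c⁻¹ * derivative B), by
      have : C c⁻¹ * C c = (1 : L[X]) := by rw [← C_mul, inv_mul_cancel₀ hc, C_1]
      linear_combination C c⁻¹ * hder - (X ^ q - X + C β) * this⟩
  have hBγ : B ∣ C γ := by
    have h1 : C γ = (X ^ q - X + C β) ^ 2 - C c⁻¹ * B ^ 2 := by
      have : C c⁻¹ * C c = (1 : L[X]) := by rw [← C_mul, inv_mul_cancel₀ hc, C_1]
      rw [hB]
      linear_combination ((X ^ q - X + C β) ^ 2 - C γ) * this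
    rw [h1]
    exact dvd_sub (hBg.trans (Dvd.intro_left _ (sq _).symm)) ((dvd_pow_self B two_ne_zero).mul_left _)
  have hBdeg : B.natDegree = 0 := by
    have := natDegree_le_of_dvd hBγ (by simpa using hγ)
    simpa using this
  have := congrArg natDegree hB
  rw [natDegree_pow, hBdeg, natDegree_C_mul hc, natDegree_sq_X_pow_sub_X_add_C_sub_C hq] at this
  omega

/-- The affine points of the curve `x + a / x = y ^ q - y + β`. -/
noncomputable def artinSchreierPoints {L : Type*} [Field L] [Fintype L] (q : ℕ) (a β : L) :
    Finset (L × L) :=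
  {z | z.1 ≠ 0 ∧ z.1 + a * z.1⁻¹ = z.2 ^ q - z.2 + β}

theorem card_artinSchreierPoints_le_of_eval_zero_ne {L : Type*} [Field L] [Fintype L]
    {p m r q e : ℕ} [Fact p.Prime] [CharP L p] (hs : p ^ m = 2 * r + 1)
    (hL : Fintype.card L = (p ^ m) ^ 2) (he : q = p ^ (e + 1)) (hqr : 2 * q ≤ r) (h2 : (2 : L) ≠ 0)
    {a β : L} (ha : a ≠ 0) (hβ : β ^ 2 - 4 * a ≠ 0) :
    #(artinSchreierPoints q a β) ≤ (p ^ m) ^ 2 + 6 * q * p ^ m := by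
  have hp := (Fact.out : p.Prime)
  have hq : 1 < q := he ▸ Nat.one_lt_pow (by omega) hp.one_lt
  have hqL : (q : L) = 0 := by rw [he]; simp
  have h4a : 4 * a ≠ 0 := by
    rw [show (4 : L) = 2 * 2 by norm_num]; exact mul_ne_zero (mul_ne_zero h2 h2) ha
  refine le_trans ?_ (card_isSquare_eval_le hs hL hqr
    (f := (X ^ q - X + C β) ^ 2 - C (4 * a)) ?_ ?_ ?_)
  · refine card_le_mul_card_image_of_maps_to (f := Prod.snd) ?_ 2 ?_
    · rintro ⟨x, y⟩ hz
      simp only [artinSchreierPoints, mem_filter, mem_univ, true_and] at hz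
      obtain ⟨hx, hxy⟩ := hz
      simp only [mem_filter, mem_univ, true_and, eval_sub, eval_pow, eval_add, eval_X, eval_C]
      rw [← hxy]
      refine ⟨x - a * x⁻¹, ?_⟩
      field_simp
      ring
    · intro y _
      by_cases hne : ({z ∈ artinSchreierPoints q a β | z.2 = y}).Nonempty
      · obtain ⟨⟨x₀, y₀⟩, hz⟩ := hne
        simp only [artinSchreierPoints, mem_filter, mem_univ, true_and] at hz
        obtain ⟨⟨hx₀, hxy₀⟩, rfl⟩ := hz
        refine (card_le_card (t := {(x₀, y₀), (a * x₀⁻¹, y₀)}) ?_).trans card_le_two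
        rintro ⟨x, y⟩ hz
        simp only [artinSchreierPoints, mem_filter, mem_univ, true_and] at hz
        obtain ⟨⟨hx, hxy⟩, rfl⟩ := hz
        rw [← hxy₀] at hxy
        have : (x - x₀) * (x - a * x₀⁻¹) = 0 := by
          field_simp at hxy ⊢
          linear_combination hxy
        rcases mul_eq_zero.mp this with h | h
        · simp [sub_eq_zero.mp h]
        · simp [sub_eq_zero.mp h]
      · rw [not_nonempty_iff_eq_empty.mp hne]; simp
  · exact (natDegree_sq_X_pow_sub_X_add_C_sub_C hq _ _).le
  · rw [coeff_zero_eq_eval_zero]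
    simpa [show q ≠ 0 by omega] using hβ
  · exact eq_zero_of_sq_eq_C_mul_sq_mul hq hqL h2 β h4a

theorem card_artinSchreierPoints_le {L : Type*} [Field L] [Fintype L]
    {p m r q e : ℕ} [Fact p.Prime] [CharP L p] (hs : p ^ m = 2 * r + 1)
    (hL : Fintype.card L = (p ^ m) ^ 2) (he : q = p ^ (e + 1)) (hqr : 2 * q ≤ r) (h2 : (2 : L) ≠ 0)
    {a : L} (ha : a ≠ 0) (β : L) :
    #(artinSchreierPoints q a β) ≤ (p ^ m) ^ 2 + 6 * q * p ^ m := by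
  have hp := (Fact.out : p.Prime)
  have hq : 1 < q := he ▸ Nat.one_lt_pow (by omega) hp.one_lt
  obtain ⟨t, ht⟩ := exists_eval_ne_zero_of_natDegree_lt_card
    ((X ^ q - X + C β) ^ 2 - C (4 * a) : L[X])
    (fun h0 => by
      have := natDegree_sq_X_pow_sub_X_add_C_sub_C hq β (4 * a)
      rw [h0, natDegree_zero] at this
      omega)
    (by
      rw [natDegree_sq_X_pow_sub_X_add_C_sub_C hq, Cardinal.mk_fintype, hL, hs]
      exact_mod_cast (by nlinarith))
  refine le_trans ?_ (card_artinSchreierPoints_le_of_eval_zero_ne hs hL he hqr h2 ha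
    (β := t ^ q - t + β) (by simpa using ht))
  refine card_le_card_of_injOn (fun z => (z.1, z.2 - t)) ?_ ?_
  · rintro ⟨x, y⟩ hz
    simp only [artinSchreierPoints, mem_coe, mem_filter, mem_univ, true_and] at hz ⊢
    refine ⟨hz.1, ?_⟩
    rw [hz.2, he, sub_pow_char_pow]
    ring
  · rintro ⟨x, y⟩ _ ⟨x', y'⟩ _ h
    simpa using h

/-- The Kloosterman sum `∑ ψ (x + a / x)` over the nonzero elements of a finite field. -/
noncomputable def kloosterman {L : Type*} [Field L] [Fintype L] (ψ : AddChar L ℂ) (a : L) : ℂ :=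
  ∑ x : L with x ≠ 0, ψ (x + a * x⁻¹)

theorem sum_mul_card_artinSchreierPoints {L : Type*} [Field L] [Fintype L] {q : ℕ}
    {ψ : AddChar L ℂ} (hψq : ∀ y, ψ (y ^ q) = ψ y) (a : L) :
    ∑ β, ψ β * #(artinSchreierPoints q a β) = Fintype.card L * kloosterman ψ a := by
  have h1 (β : L) : ψ β * #(artinSchreierPoints q a β)
      = ∑ z : L × L with z.1 ≠ 0, if z.1 + a * z.1⁻¹ - (z.2 ^ q - z.2) = β then ψ β else 0 := by
    rw [artinSchreierPoints, ← filter_filter, card_filter, Nat.cast_sum, mul_sum]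
    refine sum_congr rfl fun z _ => ?_
    rw [sub_eq_iff_eq_add, add_comm β]
    split_ifs <;> simp
  simp_rw [h1]
  rw [sum_comm]
  simp only [sum_ite_eq, mem_univ, if_true]
  have h2 (z : L × L) : ψ (z.1 + a * z.1⁻¹ - (z.2 ^ q - z.2)) = ψ (z.1 + a * z.1⁻¹) := by
    rw [AddChar.map_sub_eq_div, AddChar.map_sub_eq_div, hψq, div_self ((ψ.val_isUnit _).ne_zero), div_one]
  simp_rw [h2]
  rw [sum_filter, Fintype.sum_prod_type]
  simp [kloosterman, sum_filter, mul_sum]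

theorem norm_kloosterman_le_of_sq {L : Type*} [Field L] [Fintype L]
    {p m r q e : ℕ} [Fact p.Prime] [CharP L p] (hs : p ^ m = 2 * r + 1)
    (hL : Fintype.card L = (p ^ m) ^ 2) (he : q = p ^ (e + 1)) (hqr : 2 * q ≤ r) (h2 : (2 : L) ≠ 0)
    {ψ : AddChar L ℂ} (hψ : ψ ≠ 0) (hψq : ∀ y, ψ (y ^ q) = ψ y) {a : L} (ha : a ≠ 0) :
    ‖kloosterman ψ a‖ ≤ 6 * q * (p ^ m : ℕ) + 1 := by
  have hM := card_artinSchreierPoints_le hs hL he hqr h2 ha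
  set T := (p ^ m) ^ 2 + 6 * q * p ^ m with hT
  have hsum : ∑ β, #(artinSchreierPoints q a β) = Fintype.card L * (Fintype.card L - 1) := by
    have h1 (β : L) : #(artinSchreierPoints q a β)
        = #{z ∈ {z : L × L | z.1 ≠ 0} | z.1 + a * z.1⁻¹ - (z.2 ^ q - z.2) = β} := by
      rw [filter_filter, artinSchreierPoints]
      simp_rw [sub_eq_iff_eq_add, add_comm β]
    simp_rw [h1]
    rw [← card_eq_sum_card_fiberwise (f := fun z : L × L => z.1 + a * z.1⁻¹ - (z.2 ^ q - z.2))
      (t := univ) (fun _ _ => mem_coe.mpr (mem_univ _))]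
    have : ({z : L × L | z.1 ≠ 0} : Finset (L × L)) = ({0}ᶜ : Finset L) ×ˢ univ := by ext; simp
    rw [this, card_product, card_compl, card_singleton, card_univ, mul_comm]
  have hQ : (0 : ℝ) < Fintype.card L := by exact_mod_cast Fintype.card_pos
  have hψ0 : ∑ β, ψ β = 0 := AddChar.sum_eq_zero_iff_ne_zero.mpr hψ
  have key : (Fintype.card L : ℂ) * kloosterman ψ a
      = -∑ β, ψ β * ((T : ℝ) - #(artinSchreierPoints q a β) : ℝ) := by
    rw [← sum_mul_card_artinSchreierPoints hψq]
    push_cast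
    simp_rw [mul_sub]
    rw [sum_sub_distrib, ← sum_mul, hψ0]
    ring
  have hle : Fintype.card L * ‖kloosterman ψ a‖ ≤ Fintype.card L * (6 * q * (p ^ m : ℕ) + 1) := by
    calc Fintype.card L * ‖kloosterman ψ a‖ = ‖(Fintype.card L : ℂ) * kloosterman ψ a‖ := by simp
      _ ≤ ∑ β, ‖ψ β * ((T : ℝ) - #(artinSchreierPoints q a β) : ℝ)‖ := by
        rw [key, norm_neg]; exact norm_sum_le _ _
      _ = ∑ β, ((T : ℝ) - #(artinSchreierPoints q a β) : ℝ) := by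
        refine sum_congr rfl fun β _ => ?_
        rw [norm_mul, AddChar.norm_apply, one_mul, Complex.norm_real, Real.norm_of_nonneg]
        rw [sub_nonneg]
        exact_mod_cast hM β
      _ = Fintype.card L * (6 * q * (p ^ m : ℕ) + 1) := by
        rw [sum_sub_distrib, sum_const, card_univ, nsmul_eq_mul, ← Nat.cast_sum, hsum,
          Nat.cast_mul, Nat.cast_sub Fintype.card_pos, hT, hL]
        push_cast
        ring
  exact le_of_mul_le_mul_left hle hQ

end PolynomialMethod

theorem ringChar_ne_two_of_two_ne_zero {K : Type*} [Field K] (h2 : (2 : K) ≠ 0) :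
    ringChar K ≠ 2 := by
  intro h
  have := ringChar.Nat.cast_ringChar (R := K)
  rw [h] at this
  exact h2 (by exact_mod_cast this)

theorem sum_comp_sq_add_sum_comp_mul_sq {L R : Type*} [Field L] [Fintype L] [CommRing R]
    (h2 : ringChar L ≠ 2) {u : L} (hu : ¬ IsSquare u) (H : L → R) :
    ∑ v, H (v ^ 2) + ∑ v, H (u * v ^ 2) = 2 * ∑ w, H w := by
  have hu0 : u ≠ 0 := by rintro rfl; exact hu (IsSquare.zero)
  have h1 (g : L → L) : ∑ v, H (g v) = ∑ w, (#{v | g v = w} : R) * H w := by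
    rw [← sum_fiberwise_of_maps_to (t := univ) (g := g) (fun _ _ => mem_univ _)]
    refine sum_congr rfl fun w _ => ?_
    rw [sum_congr rfl (fun v hv => by rw [(mem_filter.mp hv).2]), sum_const, nsmul_eq_mul]
  have h3 (w : L) : ((#{v : L | v ^ 2 = w} : ℕ) : ℤ) = quadraticChar L w + 1 := by
    rw [← quadraticChar_card_sqrts h2]
    congr 2
    ext
    simp
  have h4 (w : L) : ((#{v : L | u * v ^ 2 = w} : ℕ) : ℤ) = - quadraticChar L w + 1 := by
    have : univ.filter (fun v : L => u * v ^ 2 = w)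
        = univ.filter fun v => v ^ 2 = u * w * u⁻¹ ^ 2 := by
      ext v
      simp only [mem_filter, mem_univ, true_and]
      constructor
      · rintro rfl; field_simp
      · intro h; rw [h]; field_simp
    rw [this, h3, map_mul, map_mul, quadraticChar_sq_one' (inv_ne_zero hu0),
      quadraticChar_neg_one_iff_not_isSquare.mpr hu]
    ring
  rw [h1, h1, ← sum_add_distrib, mul_sum]
  refine sum_congr rfl fun w _ => ?_
  rw [← add_mul]
  congr 1
  have := congrArg (Int.cast : ℤ → R) (congrArg₂ (· + ·) (h3 w) (h4 w))
  push_cast at this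
  rw [this]
  ring

theorem kloosterman_sq {L : Type*} [Field L] [Fintype L] (h2 : (2 : L) ≠ 0) (ψ : AddChar L ℂ)
    (a : L) : kloosterman ψ a ^ 2
      = ∑ v, ∑ r, if r ^ 2 - v ^ 2 = 0 then 0 else ψ (2 * r + a * ((r ^ 2 - v ^ 2)⁻¹ * (2 * r))) := by
  have h4 : (4 : L) ≠ 0 := by
    rw [show (4 : L) = 2 * 2 by norm_num]; exact mul_ne_zero h2 h2
  rw [kloosterman, sq, sum_mul_sum, ← sum_product', ← sum_product', sum_ite, sum_const_zero,
    zero_add]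
  symm
  refine sum_bij' (fun z _ => (z.2 + z.1, z.2 - z.1))
    (fun z _ => ((z.1 - z.2) / 2, (z.1 + z.2) / 2)) ?_ ?_ ?_ ?_ ?_
  · rintro ⟨v, r⟩ h
    simp only [mem_filter, mem_product, mem_univ, true_and] at h ⊢
    rw [sq_sub_sq] at h
    exact mul_ne_zero_iff.mp h
  · rintro ⟨x, y⟩ h
    simp only [mem_filter, mem_product, mem_univ, true_and] at h ⊢
    rwa [show ((x + y) / 2) ^ 2 - ((x - y) / 2) ^ 2 = x * y by field_simp; ring, mul_eq_zero, not_or]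
  · rintro ⟨v, r⟩ _
    ext <;> simp <;> field_simp <;> ring
  · rintro ⟨x, y⟩ _
    ext <;> simp <;> field_simp <;> ring
  · rintro ⟨v, r⟩ h
    simp only [mem_filter, mem_product, mem_univ, true_and] at h ⊢
    rw [← AddChar.map_add_eq_mul]
    congr 1
    rw [sq_sub_sq] at h ⊢
    obtain ⟨h, h'⟩ := mul_ne_zero_iff.mp h
    field_simp
    ring

section QuadraticExtension
variable {L : Type*} [Field L] {u : L}

/-- The pullback of an additive character along the trace of a quadratic extension. -/
noncomputable def quadraticPullback (u : L) (ψ : AddChar L ℂ) :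
    AddChar (QuadraticAlgebra L u 0) ℂ :=
  ψ.compAddMonoidHom (QuadraticAlgebra.trace (R := L) (a := u) (b := 0)).toAddMonoidHom

theorem quadraticPullback_apply (ψ : AddChar L ℂ) (z : QuadraticAlgebra L u 0) :
    quadraticPullback u ψ z = ψ (2 * z.re) := by
  simp [quadraticPullback, QuadraticAlgebra.trace_def]

theorem quadraticPullback_ne_zero (h2 : (2 : L) ≠ 0) {ψ : AddChar L ℂ} (hψ : ψ ≠ 0) :
    quadraticPullback u ψ ≠ 0 := by
  rw [AddChar.ne_zero_iff] at hψ ⊢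
  obtain ⟨x, hx⟩ := hψ
  refine ⟨⟨x / 2, 0⟩, ?_⟩
  rw [quadraticPullback_apply]
  rwa [mul_div_cancel₀ _ h2]

theorem quadraticPullback_pow {p e : ℕ} [Fact p.Prime] [CharP L p] {ψ : AddChar L ℂ}
    (hψ : ∀ y, ψ (y ^ p ^ e) = ψ y) (y : QuadraticAlgebra L u 0) :
    quadraticPullback u ψ (y ^ p ^ e) = quadraticPullback u ψ y := by
  have : CharP (QuadraticAlgebra L u 0) p :=
    charP_of_injective_algebraMap QuadraticAlgebra.algebraMap_injective p
  have h : QuadraticAlgebra.trace (y ^ p ^ e) = QuadraticAlgebra.trace y ^ p ^ e := by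
    apply QuadraticAlgebra.algebraMap_injective (a := u) (b := 0)
    rw [map_pow (algebraMap L _), QuadraticAlgebra.algebraMap_trace_eq_add_star,
      QuadraticAlgebra.algebraMap_trace_eq_add_star, add_pow_char_pow, star_pow]
  change ψ (QuadraticAlgebra.trace _) = ψ (QuadraticAlgebra.trace _)
  rw [h, hψ]

variable [Fintype L]

noncomputable instance : Fintype (QuadraticAlgebra L u 0) :=
  Fintype.ofEquiv _ (QuadraticAlgebra.equivProd u 0).symm

theorem card_quadraticAlgebra : Fintype.card (QuadraticAlgebra L u 0) = Fintype.card L ^ 2 := by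
  rw [Fintype.card_congr (QuadraticAlgebra.equivProd u 0), Fintype.card_prod, sq]

variable [Fact (∀ r : L, r ^ 2 ≠ u + 0 * r)]

theorem kloosterman_quadraticPullback (ψ : AddChar L ℂ) (a : L) :
    kloosterman (quadraticPullback u ψ) (algebraMap L (QuadraticAlgebra L u 0) a)
      = ∑ v, ∑ r, if r ^ 2 - u * v ^ 2 = 0 then 0 else
          ψ (2 * r + a * ((r ^ 2 - u * v ^ 2)⁻¹ * (2 * r))) := by
  have hn (z : QuadraticAlgebra L u 0) : z.norm = z.re ^ 2 - u * z.im ^ 2 := by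
    rw [QuadraticAlgebra.norm_def]; ring
  rw [kloosterman, ← sum_product']
  rw [sum_ite, sum_const_zero, zero_add]
  refine sum_bij' (fun z _ => (z.im, z.re)) (fun z _ => ⟨z.2, z.1⟩) ?_ ?_ ?_ ?_ ?_
  · intro z h
    simp only [mem_filter, mem_product, mem_univ, true_and] at h ⊢
    rwa [← hn, QuadraticAlgebra.norm_eq_zero_iff_eq_zero]
  · rintro ⟨v, r⟩ h
    simp only [mem_filter, mem_product, mem_univ, true_and] at h ⊢
    rwa [Ne, ← QuadraticAlgebra.norm_eq_zero_iff_eq_zero, hn]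
  · rintro ⟨v, r⟩ _; rfl
  · rintro ⟨v, r⟩ _; rfl
  · intro z _
    rw [quadraticPullback_apply, ← hn]
    congr 1
    simp [QuadraticAlgebra.algebraMap_re, QuadraticAlgebra.algebraMap_im]
    ring

theorem kloosterman_quadraticPullback_eq (h2 : (2 : L) ≠ 0) (hu : ¬ IsSquare u) {ψ : AddChar L ℂ}
    (hψ : ψ ≠ 0) {a : L} (ha : a ≠ 0) :
    kloosterman (quadraticPullback u ψ) (algebraMap L (QuadraticAlgebra L u 0) a)
      = 2 * Fintype.card L - kloosterman ψ a ^ 2 := by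
  have hc : ringChar L ≠ 2 := ringChar_ne_two_of_two_ne_zero h2
  have hprim : ψ.IsPrimitive := AddChar.IsPrimitive.of_ne_one hψ
  rw [eq_sub_iff_add_eq, kloosterman_quadraticPullback, kloosterman_sq h2, add_comm,
    sum_comp_sq_add_sum_comp_mul_sq hc hu (fun w => ∑ r, if r ^ 2 - w = 0 then 0 else
          ψ (2 * r + a * ((r ^ 2 - w)⁻¹ * (2 * r))))]
  congr 1
  rw [sum_comm]
  have h1 (r : L) : (∑ w, if r ^ 2 - w = 0 then 0 else ψ (2 * r + a * ((r ^ 2 - w)⁻¹ * (2 * r))))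
      = ∑ w, if w = 0 then 0 else ψ (r * (2 * (1 + a * w⁻¹))) :=
    Fintype.sum_equiv (Equiv.subLeft (r ^ 2)) _ _ fun w => by
      simp only [Equiv.subLeft_apply]
      split_ifs
      · rfl
      · congr 1; ring
  simp_rw [h1]
  rw [sum_comm]
  rw [sum_eq_single (-a)]
  · simp [ha]
  · intro w _ hw
    split_ifs with h0
    · simp
    · rw [AddChar.sum_mulShift _ hprim, if_neg, Nat.cast_zero]
      refine mul_ne_zero h2 fun h => hw ?_
      field_simp at h
      linear_combination h
  · simp
end QuadraticExtension

theorem exists_tower.{v} {L : Type v} [Field L] [Fintype L] {p e : ℕ} [Fact p.Prime] [CharP L p]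
    (h2 : (2 : L) ≠ 0) (hL : Fintype.card L = p ^ e) {ψ : AddChar L ℂ} (hψ : ψ ≠ 0)
    {a : L} (ha : a ≠ 0) {δ : ℝ} (hδ : 0 ≤ δ)
    (h : (2 + δ) * √(Fintype.card L) ≤ ‖kloosterman ψ a‖) (n : ℕ) :
    ∃ (M : Type v) (_ : Field M) (_ : Fintype M) (_ : CharP M p) (φ : AddChar M ℂ) (b : M),
      (2 : M) ≠ 0 ∧ Fintype.card M = Fintype.card L ^ 2 ^ n ∧ φ ≠ 0 ∧ (∀ y, φ (y ^ p ^ e) = φ y) ∧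
      b ≠ 0 ∧ (2 + 4 ^ n * δ) * √(Fintype.card L) ^ 2 ^ n ≤ ‖kloosterman φ b‖ := by
  induction n with
  | zero =>
    refine ⟨L, inferInstance, inferInstance, inferInstance, ψ, a, h2, by simp, hψ, fun y => ?_, ha,
      by simpa using h⟩
    rw [← hL, FiniteField.pow_card]
  | succ n ih =>
    obtain ⟨M, _, _, _, φ, b, h2', hM, hφ, hφq, hb, hle⟩ := ih
    have hchar : ringChar M ≠ 2 := ringChar_ne_two_of_two_ne_zero h2'
    obtain ⟨u, hu⟩ := FiniteField.exists_nonsquare hchar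
    have : Fact (∀ r : M, r ^ 2 ≠ u + 0 * r) :=
      ⟨fun r hr => hu ⟨r, by rw [← sq, hr]; ring⟩⟩
    refine ⟨QuadraticAlgebra M u 0, inferInstance, inferInstance,
      charP_of_injective_algebraMap QuadraticAlgebra.algebraMap_injective p,
      quadraticPullback u φ, algebraMap _ _ b, ?_, ?_, quadraticPullback_ne_zero h2' hφ,
      quadraticPullback_pow hφq, ?_, ?_⟩
    · rw [← map_ofNat (algebraMap M (QuadraticAlgebra M u 0)) 2]
      exact (map_ne_zero _).mpr h2'
    · rw [card_quadraticAlgebra, hM, ← pow_mul, pow_succ]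
    · exact (map_ne_zero _).mpr hb
    · rw [kloosterman_quadraticPullback_eq h2' hu hφ hb, hM]
      set N := √(Fintype.card L) ^ 2 ^ n with hN
      have hN0 : 0 ≤ N := by positivity
      have hN2 : ((Fintype.card L ^ 2 ^ n : ℕ) : ℝ) = N ^ 2 := by
        rw [hN, ← pow_mul, mul_comm, pow_mul, Real.sq_sqrt (by positivity)]
        push_cast
        rfl
      have h4 : ‖kloosterman φ b‖ ^ 2 - 2 * N ^ 2
          ≤ ‖(2 * (Fintype.card L ^ 2 ^ n : ℕ) : ℂ) - kloosterman φ b ^ 2‖ := by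
        rw [norm_sub_rev, ← norm_pow, ← hN2]
        refine le_trans (le_of_eq ?_) (norm_sub_norm_le _ _)
        rw [norm_mul, Complex.norm_natCast]
        simp
      refine le_trans ?_ h4
      have h5 : (0 : ℝ) ≤ 4 ^ n * δ := by positivity
      have h6 : √(Fintype.card L) ^ 2 ^ (n + 1) = N ^ 2 := by rw [hN, ← pow_mul, pow_succ]
      rw [h6]
      have h7 := pow_le_pow_left₀ (by positivity) hle 2
      rw [pow_succ]
      nlinarith [mul_nonneg (sq_nonneg (4 ^ n * δ)) (sq_nonneg N)]

/-- Weil's bound for Kloosterman sums in odd characteristic. -/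
theorem norm_kloosterman_le {L : Type*} [Field L] [Fintype L] (h2 : (2 : L) ≠ 0)
    {ψ : AddChar L ℂ} (hψ : ψ ≠ 0) {a : L} (ha : a ≠ 0) :
    ‖kloosterman ψ a‖ ≤ 2 * √(Fintype.card L) := by
  obtain ⟨p, _⟩ := CharP.exists L
  obtain ⟨⟨e, he⟩, hp, hcard⟩ := FiniteField.card L p
  have : Fact p.Prime := ⟨hp⟩
  obtain ⟨e, rfl⟩ := Nat.exists_eq_succ_of_ne_zero he.ne'
  simp only [PNat.mk_coe, Nat.succ_eq_add_one] at hcard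
  by_contra! hlt
  have hq0 : (0 : ℝ) < √(Fintype.card L) := Real.sqrt_pos.mpr (by exact_mod_cast Fintype.card_pos)
  obtain ⟨δ, hδ, hle⟩ : ∃ δ : ℝ, 0 < δ ∧ (2 + δ) * √(Fintype.card L) ≤ ‖kloosterman ψ a‖ := by
    refine ⟨‖kloosterman ψ a‖ / √(Fintype.card L) - 2, ?_, ?_⟩
    · rwa [sub_pos, lt_div_iff₀ hq0]
    · field_simp; simp
  set q := Fintype.card L with hq
  obtain ⟨n₀, hn₀⟩ := pow_unbounded_of_one_lt ((6 * q + 1) / δ) (by norm_num : (1 : ℝ) < 4)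
  set n := n₀ + 2 with hn
  obtain ⟨M, _, _, _, φ, b, h2', hM, hφ, hφq, hb, hK⟩ :=
    exists_tower h2 hcard hψ ha hδ.le hle (n + 1)
  have hp2 : p ≠ 2 := by
    rintro rfl
    exact h2 (by exact_mod_cast CharP.cast_eq_zero L 2)
  set m := (e + 1) * 2 ^ n with hm
  have hs : p ^ m = q ^ 2 ^ n := by rw [hm, pow_mul, hcard]
  have hodd : Odd (p ^ m) := (hp.odd_of_ne_two hp2).pow
  obtain ⟨r, hr⟩ := hodd
  have hq3 : 3 ≤ q := by
    have : 3 ≤ p := by have := hp.two_le; omega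
    rw [hcard]
    exact this.trans (Nat.le_self_pow (by omega) p)
  have hqr : 2 * q ≤ r := by
    have h1 : q ^ 4 ≤ q ^ 2 ^ n := by
      refine Nat.pow_le_pow_right (by omega) ?_
      rw [hn, pow_add]
      exact Nat.le_mul_of_pos_left 4 (by positivity)
    have h3 : 4 * q + 1 ≤ q ^ 4 := by
      have : 27 ≤ q ^ 3 := Nat.pow_le_pow_left hq3 3
      nlinarith
    omega
  have hbound := norm_kloosterman_le_of_sq hr
    (by rw [hM, hs, ← pow_mul, pow_succ]) hcard hqr h2' hφ (by rw [hcard]; exact hφq) hb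
  have hN : √(q : ℝ) ^ 2 ^ (n + 1) = (p ^ m : ℕ) := by
    rw [hs, pow_succ 2 n, mul_comm, pow_mul, Real.sq_sqrt (by positivity)]
    push_cast
    rfl
  rw [hN] at hK
  have hs1 : (1 : ℝ) ≤ (p ^ m : ℕ) := by exact_mod_cast Nat.one_le_pow _ _ hp.pos
  have h4 : (6 * q + 1 : ℝ) < 4 ^ (n + 1) * δ := by
    rw [div_lt_iff₀ hδ] at hn₀
    refine hn₀.trans_le (mul_le_mul_of_nonneg_right ?_ hδ.le)
    exact pow_le_pow_right₀ (by norm_num) (by omega)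
  nlinarith
theorem sum_addChar_polar {K V : Type*} [Field K] [Fintype K] [AddCommGroup V]
    [Module K V] [Fintype V] {ψ : AddChar K ℂ} (hψ : ψ ≠ 0) {Q : QuadraticForm K V}
    (hQ : ∀ x, (∀ y, Q (x + y) - Q x - Q y = 0) → x = 0) (y : V) :
    ∑ x, ψ (QuadraticMap.polar Q x y) = if y = 0 then (Fintype.card V : ℂ) else 0 := by
  split_ifs with hy
  · simp [hy]
  obtain ⟨z, hz⟩ : ∃ z, QuadraticMap.polar Q z y ≠ 0 := by
    by_contra! h
    exact hy (hQ y fun z => (QuadraticMap.polar_comm Q y z).trans (h z))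
  change ∑ x, ψ.compAddMonoidHom ((QuadraticMap.polarBilin Q).flip y).toAddMonoidHom x = 0
  rw [AddChar.sum_eq_zero_iff_ne_zero, AddChar.ne_zero_iff]
  obtain ⟨w, hw⟩ := AddChar.ne_zero_iff.mp hψ
  refine ⟨(w / QuadraticMap.polar Q z y) • z, ?_⟩
  change ψ (QuadraticMap.polar Q _ y) ≠ 1
  rwa [QuadraticMap.polar_smul_left, smul_eq_mul, div_mul_cancel₀ _ hz]

theorem norm_sq_sum_addChar_quadraticForm {K V : Type*} [Field K] [Fintype K] [AddCommGroup V]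
    [Module K V] [Fintype V] {ψ : AddChar K ℂ} (hψ : ψ ≠ 0) (Q : QuadraticForm K V)
    (hQ : ∀ x, (∀ y, Q (x + y) - Q x - Q y = 0) → x = 0) :
    ‖∑ x, ψ (Q x)‖ ^ 2 = Fintype.card V := by
  have h : (starRingEnd ℂ) (∑ x, ψ (Q x)) * ∑ x, ψ (Q x) = Fintype.card V := by
    rw [map_sum, sum_mul_sum]
    have h1 (x : V) : ∑ y, (starRingEnd ℂ) (ψ (Q x)) * ψ (Q y)
        = ∑ y, ψ (Q y) * ψ (QuadraticMap.polar Q x y) := by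
      refine (Fintype.sum_equiv (Equiv.addRight x) _ _ fun y => ?_).symm
      rw [← AddChar.map_neg_eq_conj, ← AddChar.map_add_eq_mul, ← AddChar.map_add_eq_mul]
      congr 1
      simp only [Equiv.coe_addRight, QuadraticMap.polar, add_comm x y]
      ring
    simp_rw [h1]
    rw [sum_comm]
    simp_rw [← mul_sum, sum_addChar_polar hψ hQ]
    simp
  rw [mul_comm, Complex.mul_conj, Complex.normSq_eq_norm_sq] at h
  exact_mod_cast h

section
variable {K : Type*} [Field K] [Fintype K]

theorem sum_filter_ne_zero_eq_sub (f : K → ℂ) : ∑ s with s ≠ 0, f s = ∑ s, f s - f 0 := by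
  rw [← sum_erase_eq_sub (mem_univ 0)]
  congr 1
  ext
  simp

/-- The quadratic Gauss sum `∑ ψ (x ^ 2)`. -/
noncomputable def quadraticGaussSum (ψ : AddChar K ℂ) : ℂ := ∑ x, ψ (x ^ 2)

theorem norm_sq_quadraticGaussSum (h2 : (2 : K) ≠ 0) {ψ : AddChar K ℂ} (hψ : ψ ≠ 0) :
    ‖quadraticGaussSum ψ‖ ^ 2 = Fintype.card K := by
  rw [← norm_sq_sum_addChar_quadraticForm hψ QuadraticMap.sq]
  · simp [quadraticGaussSum, sq]
  · intro x h
    have := h 1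
    simp only [QuadraticMap.sq_apply] at this
    have h3 : 2 * x = 0 := by linear_combination this
    exact (mul_eq_zero.mp h3).resolve_left h2

theorem sum_addChar_mul_sq (h2 : (2 : K) ≠ 0) {ψ : AddChar K ℂ} (hψ : ψ ≠ 0) {s : K} (hs : s ≠ 0) :
    ∑ x, ψ (s * x ^ 2) = quadraticChar K s * quadraticGaussSum ψ := by
  by_cases hsq : IsSquare s
  · rw [(quadraticChar_one_iff_isSquare hs).mpr hsq, Int.cast_one, one_mul]
    obtain ⟨t, rfl⟩ := hsq
    have ht : t ≠ 0 := left_ne_zero_of_mul hs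
    exact Fintype.sum_equiv (Equiv.mulLeft₀ t ht) _ _ fun x => by
      change ψ _ = ψ ((t * x) ^ 2); congr 1; ring
  · rw [quadraticChar_neg_one_iff_not_isSquare.mpr hsq]
    have h := sum_comp_sq_add_sum_comp_mul_sq (ringChar_ne_two_of_two_ne_zero h2) hsq ψ
    rw [AddChar.sum_eq_zero_iff_ne_zero.mpr hψ, mul_zero] at h
    rw [quadraticGaussSum]
    push_cast
    linear_combination h

/-- The sum `∑ χ(s) ^ d ψ (a s + b / s)`, `χ` being the quadratic character. -/
noncomputable def twistedKloosterman (d : ℕ) (ψ : AddChar K ℂ) (a b : K) : ℂ :=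
  ∑ s : K with s ≠ 0, (quadraticChar K s : ℂ) ^ d * ψ (a * s + b * s⁻¹)

theorem twistedKloosterman_comm (d : ℕ) (ψ : AddChar K ℂ) (a b : K) :
    twistedKloosterman d ψ a b = twistedKloosterman d ψ b a := by
  refine sum_nbij' (·⁻¹) (·⁻¹) ?_ ?_ ?_ ?_ ?_
  · simp
  · simp
  · simp
  · simp
  · intro s hs
    have hs : s ≠ 0 := by simpa using hs
    rw [inv_inv, add_comm]
    congr 3
    have h1 : quadraticChar K s * quadraticChar K s⁻¹ = 1 := by
      rw [← map_mul, mul_inv_cancel₀ hs, map_one]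
    have h3 := quadraticChar_sq_one hs
    linear_combination (- quadraticChar K s) * h1 + quadraticChar K s⁻¹ * h3

theorem norm_salie_le (h2 : (2 : K) ≠ 0) {ψ : AddChar K ℂ} (hψ : ψ ≠ 0) (a : K) {b : K}
    (hb : b ≠ 0) : ‖twistedKloosterman 1 ψ a b‖ ≤ 3 * √(Fintype.card K) := by
  have h4 : (-4 : K) ≠ 0 := by
    rw [show (-4 : K) = -(2 * 2) by norm_num]; exact neg_ne_zero.mpr (mul_ne_zero h2 h2)
  set c : K := -4 * b with hc
  have hc0 : c ≠ 0 := mul_ne_zero h4 hb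
  set φ : AddChar K ℂ := ψ.mulShift c with hφ
  have hφ0 : φ ≠ 0 := AddChar.IsPrimitive.of_ne_one hψ hc0
  have hprim : φ.IsPrimitive := AddChar.IsPrimitive.of_ne_one hφ0
  set g := quadraticGaussSum φ with hg
  set t := a / c with ht
  have key : g * twistedKloosterman 1 ψ a b
      = ∑ x : K, φ x * ((if x ^ 2 + t = 0 then (Fintype.card K : ℂ) else 0) - 1) := by
    have h1 (s : K) (hs : s ≠ 0) : g * ((quadraticChar K s : ℂ) ^ 1 * ψ (a * s + b * s⁻¹))
        = ∑ x, φ x * φ (s * (x ^ 2 + t)) := by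
      have h3 : ψ (a * s + b * s⁻¹) = φ (t * s - (4 * s)⁻¹) := by
        rw [hφ, AddChar.mulShift_apply]
        congr 1
        rw [ht, hc]
        have : (4 : K) ≠ 0 := by simpa using h4
        field_simp
        ring
      rw [h3, pow_one, ← mul_assoc, mul_comm g, ← sum_addChar_mul_sq h2 hφ0 hs, sum_mul]
      refine Fintype.sum_equiv (Equiv.subRight (2 * s)⁻¹) _ _ fun x => ?_
      rw [← AddChar.map_add_eq_mul, ← AddChar.map_add_eq_mul]
      congr 1
      simp only [Equiv.subRight_apply]
      have : (4 : K) ≠ 0 := by simpa using h4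
      field_simp
      ring
    rw [twistedKloosterman, mul_sum, sum_congr rfl (fun s hs => h1 s (by simpa using hs)), sum_comm]
    refine sum_congr rfl fun x _ => ?_
    rw [← mul_sum]
    congr 1
    rw [sum_filter_ne_zero_eq_sub, AddChar.sum_mulShift (x ^ 2 + t) hprim, zero_mul,
      AddChar.map_zero_eq_one]
    split_ifs <;> simp
  have hgn := norm_sq_quadraticGaussSum h2 hφ0
  have hq : (0 : ℝ) < Fintype.card K := by exact_mod_cast Fintype.card_pos
  have hgs : ‖g‖ = √(Fintype.card K) := by
    rw [← hgn, Real.sqrt_sq (norm_nonneg _)]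
  have hcount : #{x : K | x ^ 2 + t = 0} ≤ 2 := by
    by_cases hne : ({x : K | x ^ 2 + t = 0} : Finset K).Nonempty
    · obtain ⟨y, hy⟩ := hne
      refine (card_le_card (t := {y, -y}) fun x hx => ?_).trans card_le_two
      simp only [mem_filter, mem_univ, true_and] at hx hy
      have : (x - y) * (x + y) = 0 := by linear_combination hx - hy
      simpa [sub_eq_zero, add_eq_zero_iff_eq_neg] using this
    · rw [not_nonempty_iff_eq_empty.mp hne]; simp
  have hle : ‖g‖ * ‖twistedKloosterman 1 ψ a b‖ ≤ 3 * Fintype.card K := by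
    rw [← norm_mul, key]
    calc _ ≤ ∑ x : K, ((if x ^ 2 + t = 0 then (Fintype.card K : ℝ) else 0) + 1) := by
          refine norm_sum_le_of_le _ fun x _ => ?_
          rw [norm_mul, AddChar.norm_apply, one_mul]
          refine (norm_sub_le _ _).trans ?_
          split_ifs <;> simp
      _ = #{x : K | x ^ 2 + t = 0} * Fintype.card K + Fintype.card K := by
          rw [sum_add_distrib, ← sum_filter]; simp
      _ ≤ 2 * Fintype.card K + Fintype.card K := by gcongr; exact_mod_cast hcount
      _ = 3 * Fintype.card K := by ring
  rw [hgs] at hle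
  have h5 := Real.sqrt_pos.mpr hq
  refine le_of_mul_le_mul_left (hle.trans (le_of_eq ?_)) h5
  rw [mul_left_comm, Real.mul_self_sqrt hq.le]

theorem norm_twistedKloosterman_le (h2 : (2 : K) ≠ 0) {ψ : AddChar K ℂ} (hψ : ψ ≠ 0) (d : ℕ)
    {a : K} (ha : a ≠ 0) (b : K) :
    ‖twistedKloosterman d ψ a b‖ ≤ 3 * √(Fintype.card K) := by
  have hprim : ψ.IsPrimitive := AddChar.IsPrimitive.of_ne_one hψ
  have h1 : 1 ≤ √(Fintype.card K : ℝ) :=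
    Real.one_le_sqrt.mpr (by exact_mod_cast Fintype.card_pos)
  have hχ (s : K) (hs : s ≠ 0) : (quadraticChar K s : ℂ) ^ 2 = 1 := by
    exact_mod_cast quadraticChar_sq_one hs
  rcases Nat.even_or_odd' d with ⟨k, rfl | rfl⟩
  · have h3 : twistedKloosterman (2 * k) ψ a b = ∑ s : K with s ≠ 0, ψ (s + a * b * s⁻¹) := by
      refine sum_nbij' (a * ·) (a⁻¹ * ·) ?_ ?_ ?_ ?_ ?_
      · simp [ha]
      · simp [ha]
      · simp [ha]
      · simp [ha]
      · intro s hs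
        rw [pow_mul, hχ s (by simpa using hs), one_pow, one_mul]
        congr 1
        field_simp
    rw [h3]
    by_cases hb : b = 0
    · simp only [hb, mul_zero, zero_mul, add_zero]
      rw [sum_filter_ne_zero_eq_sub, AddChar.sum_eq_zero_iff_ne_zero.mpr hψ,
        AddChar.map_zero_eq_one, zero_sub, norm_neg, norm_one]
      linarith
    · refine (norm_kloosterman_le h2 hψ (mul_ne_zero ha hb)).trans ?_
      linarith
  · have h3 : twistedKloosterman (2 * k + 1) ψ a b = twistedKloosterman 1 ψ a b := by
      refine sum_congr rfl fun s hs => ?_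
      rw [pow_succ, pow_mul, hχ s (by simpa using hs), one_pow, one_mul, pow_one]
    rw [h3, twistedKloosterman_comm]
    exact norm_salie_le h2 hψ b ha
end

theorem AddChar.map_sum_eq_prod {A M ι : Type*} [AddCommMonoid A] [CommMonoid M] (ψ : AddChar A M)
    (s : Finset ι) (f : ι → A) : ψ (∑ i ∈ s, f i) = ∏ i ∈ s, ψ (f i) :=
  map_prod ψ.toMonoidHom (fun i => Multiplicative.ofAdd (f i)) s

theorem sum_addChar_polar_sub_mul {K V : Type*} [Field K] [AddCommGroup V] [Module K V]
    [Fintype V] (ψ : AddChar K ℂ) (Q : QuadraticForm K V) {s : K}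
    (hs : s ≠ 0) (z : V) : ∑ m, ψ (QuadraticMap.polar Q m z - s⁻¹ * Q m)
      = ψ (s * Q z) * ∑ m, ψ (-s⁻¹ * Q m) := by
  rw [mul_sum]
  refine (Fintype.sum_equiv (Equiv.addRight (s • z)) _ _ fun m => ?_).symm
  rw [← AddChar.map_add_eq_mul]
  congr 1
  have h1 : Q (m + s • z) = QuadraticMap.polar Q m (s • z) + Q m + Q (s • z) := by
    rw [QuadraticMap.polar]; ring
  have h2 : QuadraticMap.polar Q z z = 2 * Q z := by
    rw [QuadraticMap.polar_self]; simp
  simp only [Equiv.coe_addRight]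
  rw [h1, QuadraticMap.polar_smul_right, QuadraticMap.polar_add_left, QuadraticMap.polar_smul_left,
    QuadraticMap.map_smul, h2]
  simp only [smul_eq_mul]
  field_simp
  ring

section
variable {K V : Type*} [Field K] [Fintype K] [AddCommGroup V] [Module K V] [Fintype V]

theorem sum_addChar_mul_quadraticForm (h2 : (2 : K) ≠ 0) {ψ : AddChar K ℂ} (hψ : ψ ≠ 0)
    {Q : QuadraticForm K V} (hQ : ∀ x, (∀ y, Q (x + y) - Q x - Q y = 0) → x = 0) {r : K}
    (hr : r ≠ 0) :
    ∑ x, ψ (r * Q x) = (quadraticChar K r : ℂ) ^ Module.finrank K V * ∑ x, ψ (Q x) := by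
  have : Invertible (2 : K) := invertibleOfNonzero h2
  have : FiniteDimensional K V := Module.Finite.of_finite
  obtain ⟨w, ⟨e⟩⟩ := QuadraticForm.equivalent_weightedSumSquares_units_of_nondegenerate' Q (by
    intro x hx
    refine hQ x fun y => ?_
    have := hx y
    have h := congrArg (fun b => b x y) (QuadraticMap.two_nsmul_associated K Q)
    simp only [LinearMap.smul_apply, this, smul_zero, QuadraticMap.polarBilin_apply_apply] at h
    exact h.symm)
  have key (r : K) (hr : r ≠ 0) : ∑ x, ψ (r * Q x)
      = ∏ i, ((quadraticChar K r : ℂ) * (quadraticChar K (w i) * quadraticGaussSum ψ)) := by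
    have h1 : ∑ x, ψ (r * Q x)
        = ∑ y : Fin (Module.finrank K V) → K, ∏ i, ψ (r * w i * y i ^ 2) := by
      refine Fintype.sum_equiv e.toEquiv _ _ fun x => ?_
      rw [← e.map_app x, QuadraticMap.weightedSumSquares_apply, mul_sum, AddChar.map_sum_eq_prod]
      refine prod_congr rfl fun i _ => ?_
      congr 1
      rw [Units.smul_def, smul_eq_mul, mul_assoc, sq]
      rfl
    rw [h1, ← Fintype.piFinset_univ, ← prod_univ_sum (fun _ => univ) fun i x => ψ (r * w i * x ^ 2)]
    refine prod_congr rfl fun i _ => ?_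
    rw [sum_addChar_mul_sq h2 hψ (mul_ne_zero hr (w i).ne_zero), map_mul]
    push_cast
    ring
  have h3 := key 1 one_ne_zero
  simp only [one_mul, map_one, Int.cast_one] at h3
  rw [key r hr, prod_mul_distrib, h3]
  simp

theorem gaussSum_mul_sum_addChar (h2 : (2 : K) ≠ 0) {ψ : AddChar K ℂ} (hψ : ψ ≠ 0)
    {Q : QuadraticForm K V} (hQ : ∀ x, (∀ y, Q (x + y) - Q x - Q y = 0) → x = 0) (t : K) (z : V) :
    (∑ x, ψ (-1 * Q x)) * ∑ s : K with s ≠ 0, ψ (s * (Q z - t))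
      = ∑ m, twistedKloosterman (Module.finrank K V) ψ (-t) (-Q m) *
          ψ (QuadraticMap.polar Q m z) := by
  simp_rw [twistedKloosterman, mul_sum, sum_mul (s := univ.filter _)]
  rw [sum_comm]
  refine sum_congr rfl fun s hs => ?_
  have hs : s ≠ 0 := by simpa using hs
  have h3 : (quadraticChar K s : ℂ) * quadraticChar K (-s⁻¹) = quadraticChar K (-1) := by
    rw [← Int.cast_mul, ← map_mul]
    congr 2
    field_simp
  have h4 := sum_addChar_polar_sub_mul ψ Q hs z
  rw [sum_addChar_mul_quadraticForm h2 hψ hQ (neg_ne_zero.mpr (inv_ne_zero hs))] at h4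
  rw [sum_addChar_mul_quadraticForm h2 hψ hQ (neg_ne_zero.mpr one_ne_zero), ← h3, mul_pow]
  have h5 (m : V) : (quadraticChar K s : ℂ) ^ Module.finrank K V * ψ (-t * s + -Q m * s⁻¹)
      * ψ (QuadraticMap.polar Q m z) = (quadraticChar K s : ℂ) ^ Module.finrank K V * ψ (-t * s) *
        ψ (QuadraticMap.polar Q m z - s⁻¹ * Q m) := by
    rw [mul_assoc, mul_assoc, ← AddChar.map_add_eq_mul, ← AddChar.map_add_eq_mul]
    congr 2
    ring
  simp_rw [h5]
  rw [← mul_sum, h4, show s * (Q z - t) = s * Q z + -t * s by ring, AddChar.map_add_eq_mul]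
  ring

theorem sum_norm_sq_sum_addChar_polar {ψ : AddChar K ℂ} (hψ : ψ ≠ 0)
    {Q : QuadraticForm K V} (hQ : ∀ x, (∀ y, Q (x + y) - Q x - Q y = 0) → x = 0) (A : Finset V) :
    ∑ m, ‖∑ x ∈ A, ψ (QuadraticMap.polar Q m x)‖ ^ 2 = Fintype.card V * #A := by
  have h (m : V) : ((‖∑ x ∈ A, ψ (QuadraticMap.polar Q m x)‖ ^ 2 : ℝ) : ℂ)
      = ∑ x ∈ A, ∑ y ∈ A, ψ (QuadraticMap.polar Q m (x - y)) := by
    rw [← Complex.normSq_eq_norm_sq, ← Complex.mul_conj, map_sum, sum_mul_sum]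
    refine sum_congr rfl fun x _ => sum_congr rfl fun y _ => ?_
    rw [← AddChar.map_neg_eq_conj, ← AddChar.map_add_eq_mul, QuadraticMap.polar_sub_right]
    congr 1
    ring
  have h3 : ((∑ m, ‖∑ x ∈ A, ψ (QuadraticMap.polar Q m x)‖ ^ 2 : ℝ) : ℂ)
      = (Fintype.card V * #A : ℝ) := by
    rw [Complex.ofReal_sum]
    simp_rw [h]
    rw [sum_comm]
    simp_rw [sum_comm (s := univ), sum_addChar_polar hψ hQ, sub_eq_zero]
    simp [mul_comm]
  exact_mod_cast h3

/-- The number of pairs in `A × B` at `Q`-distance `t`. -/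
noncomputable def pairCount (Q : QuadraticForm K V) (t : K) (A B : Finset V) : ℕ :=
  #{z ∈ A ×ˢ B | Q (z.1 - z.2) = t}

theorem abs_card_mul_pairCount_sub_le (h2 : (2 : K) ≠ 0) {Q : QuadraticForm K V}
    (hQ : ∀ x, (∀ y, Q (x + y) - Q x - Q y = 0) → x = 0) {t : K} (ht : t ≠ 0) (A B : Finset V) :
    |Fintype.card K * (pairCount Q t A B : ℝ) - #A * #B|
      ≤ 3 * √(Fintype.card K) * √(Fintype.card V) * √(#A * #B) := by
  obtain ⟨ψ, hψ⟩ : ∃ ψ : AddChar K ℂ, ψ ≠ 0 := by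
    obtain ⟨ψ, h⟩ := AddChar.exists_apply_ne_zero.mpr (one_ne_zero (α := K))
    exact ⟨ψ, fun h0 => h (by simp [h0])⟩
  have hprim : ψ.IsPrimitive := AddChar.IsPrimitive.of_ne_one hψ
  set g := ∑ x, ψ (-1 * Q x) with hg
  have hgn : ‖g‖ = √(Fintype.card V) := by
    rw [← norm_sq_sum_addChar_quadraticForm (AddChar.IsPrimitive.of_ne_one hψ
      (neg_ne_zero.mpr one_ne_zero) : ψ.mulShift (-1) ≠ 0) Q hQ, Real.sqrt_sq (norm_nonneg _)]
    rfl
  have h3 : ((Fintype.card K * (pairCount Q t A B : ℝ) - #A * #B : ℝ) : ℂ)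
      = ∑ x ∈ A, ∑ y ∈ B, ∑ s : K with s ≠ 0, ψ (s * (Q (x - y) - t)) := by
    simp_rw [sum_filter_ne_zero_eq_sub, AddChar.sum_mulShift _ hprim, sub_eq_zero]
    rw [← sum_product', pairCount, sum_sub_distrib]
    push_cast
    rw [← sum_filter]
    simp [mul_comm]
  have h4 : g * ((Fintype.card K * (pairCount Q t A B : ℝ) - #A * #B : ℝ) : ℂ)
      = ∑ m, twistedKloosterman (Module.finrank K V) ψ (-t) (-Q m) *
        ((∑ x ∈ A, ψ (QuadraticMap.polar Q m x)) *
          (starRingEnd ℂ) (∑ y ∈ B, ψ (QuadraticMap.polar Q m y))) := by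
    rw [h3, mul_sum]
    simp_rw [mul_sum (s := B), hg, gaussSum_mul_sum_addChar h2 hψ hQ, map_sum, sum_mul_sum, mul_sum]
    rw [sum_comm (s := univ)]
    refine sum_congr rfl fun x _ => ?_
    rw [sum_comm (s := univ)]
    refine sum_congr rfl fun y _ => sum_congr rfl fun m _ => ?_
    rw [← AddChar.map_neg_eq_conj, ← AddChar.map_add_eq_mul, QuadraticMap.polar_sub_right,
      sub_eq_add_neg]
  have h5 := congrArg norm h4
  rw [norm_mul, Complex.norm_real, Real.norm_eq_abs, hgn] at h5
  have hV : (0 : ℝ) < Fintype.card V := by exact_mod_cast Fintype.card_pos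
  refine le_of_mul_le_mul_left (h5.trans_le ?_) (Real.sqrt_pos.mpr hV)
  calc _ ≤ ∑ m, 3 * √(Fintype.card K) * (‖∑ x ∈ A, ψ (QuadraticMap.polar Q m x)‖ *
        ‖∑ y ∈ B, ψ (QuadraticMap.polar Q m y)‖) := by
        refine norm_sum_le_of_le _ fun m _ => ?_
        rw [norm_mul, norm_mul, RCLike.norm_conj]
        gcongr
        exact norm_twistedKloosterman_le h2 hψ _ (neg_ne_zero.mpr ht) _
    _ ≤ 3 * √(Fintype.card K) * (√(Fintype.card V * #A) * √(Fintype.card V * #B)) := by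
        rw [← mul_sum]
        gcongr
        rw [← sum_norm_sq_sum_addChar_polar hψ hQ A, ← sum_norm_sq_sum_addChar_polar hψ hQ B]
        exact Real.sum_mul_le_sqrt_mul_sqrt _ _ _
    _ = _ := by
        rw [Real.sqrt_mul hV.le, Real.sqrt_mul hV.le, Real.sqrt_mul (Nat.cast_nonneg _)]
        ring
end

theorem card_bad_mul_card_le {V : Type*} {q M : ℝ} {r : V → V → Prop}
    (hr : ∀ A B : Finset V, |q * (#{z ∈ A ×ˢ B | r z.1 z.2} : ℝ) - #A * #B| ≤ M * √(#A * #B))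
    (A W : Finset V) :
    (#{x ∈ A | 2 * q * #{y ∈ W | r x y} < #W} : ℝ) * #W ≤ 4 * M ^ 2 := by
  set D := {x ∈ A | 2 * q * #{y ∈ W | r x y} < #W} with hD
  have h1 : 2 * (q * (#{z ∈ D ×ˢ W | r z.1 z.2} : ℝ)) ≤ #D * #W := by
    have h3 : (#{z ∈ D ×ˢ W | r z.1 z.2} : ℝ) = ∑ x ∈ D, (#{y ∈ W | r x y} : ℝ) := by
      rw [card_filter, sum_product]
      simp_rw [card_filter]
      push_cast
      rfl
    rw [h3, mul_sum, mul_sum, ← nsmul_eq_mul, ← sum_const]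
    refine sum_le_sum fun x hx => ?_
    have := (mem_filter.mp hx).2
    linarith
  have h2 := (neg_le_abs _).trans (hr D W)
  set S : ℝ := #D * #W with hS
  have hS0 : 0 ≤ S := by positivity
  have h4 : S ≤ 2 * (M * √S) := by linarith
  have h5 := Real.sq_sqrt hS0
  have h6 : √S * √S ≤ 2 * M * √S := by nlinarith
  have h7 := Real.sqrt_nonneg S
  rcases h7.eq_or_lt with h0 | h0
  · rw [← h5, ← h0]; nlinarith [sq_nonneg M]
  · have := le_of_mul_le_mul_right h6 h0
    rw [← h5]
    nlinarith

/-- Greedy embedding of a complete graph whose edges are labelled by pseudorandom relations. -/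
theorem exists_embedding_of_mixing {V : Type*} {q M μ N : ℝ} (hq : 0 < q) (hμ : 0 < μ)
    (hμM : N * (4 * M ^ 2) < μ ^ 2) (k : ℕ) (hk : k ≤ N)
    (r : Fin (k + 1) → Fin (k + 1) → V → V → Prop)
    (hr : ∀ i j, ∀ A B : Finset V,
      |q * (#{z ∈ A ×ˢ B | r i j z.1 z.2} : ℝ) - #A * #B| ≤ M * √(#A * #B))
    (h1 : 1 ≤ 2 * q) (W : Fin (k + 1) → Finset V) (hW : ∀ i, μ * (2 * q) ^ k ≤ 2 * q * #(W i)) :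
    ∃ x : Fin (k + 1) → V, (∀ i, x i ∈ W i) ∧ ∀ i j, i < j → r i j (x i) (x j) := by
  induction k with
  | zero =>
    obtain ⟨x, hx⟩ : (W 0).Nonempty := by
      rw [nonempty_iff_ne_empty]
      intro h
      have := hW 0
      rw [h] at this
      simp at this
      linarith
    exact ⟨fun _ => x, fun i => by rwa [Fin.fin_one_eq_zero i], fun i j hij => by omega⟩
  | succ k ih =>
    have hW' (i) : μ * (2 * q) ^ k ≤ #(W i) := by
      have := hW i
      rw [pow_succ] at this
      refine le_of_mul_le_mul_left (?_ : 2 * q * _ ≤ 2 * q * _) (by positivity)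
      linarith
    have hWμ (i) : μ ≤ #(W i) :=
      (le_mul_of_one_le_right hμ.le (one_le_pow₀ h1)).trans (hW' i)
    let D : Fin (k + 1) → Finset V := fun j =>
      {x ∈ W 0 | 2 * q * #{y ∈ W j.succ | r 0 j.succ x y} < #(W j.succ)}
    have hD (j) : (#(D j) : ℝ) * μ ≤ 4 * M ^ 2 :=
      (mul_le_mul_of_nonneg_left (hWμ j.succ) (Nat.cast_nonneg _)).trans
        (card_bad_mul_card_le (hr 0 j.succ) (W 0) (W j.succ))
    obtain ⟨x₀, hx₀, hx₀D⟩ : ∃ x ∈ W 0, x ∉ univ.biUnion D := by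
      by_contra! h
      have h2 : (#(W 0) : ℝ) ≤ ∑ j, (#(D j) : ℝ) := by
        exact_mod_cast (card_le_card fun x hx => h x hx).trans card_biUnion_le
      have h3 : μ ^ 2 ≤ ((k + 1 : ℕ) : ℝ) * (4 * M ^ 2) := calc
        μ ^ 2 ≤ #(W 0) * μ := by rw [sq]; exact mul_le_mul_of_nonneg_right (hWμ 0) hμ.le
        _ ≤ (∑ j, (#(D j) : ℝ)) * μ := mul_le_mul_of_nonneg_right h2 hμ.le
        _ ≤ ∑ _j : Fin (k + 1), 4 * M ^ 2 := by rw [sum_mul]; exact sum_le_sum fun j _ => hD j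
        _ = _ := by simp
      have h4 : ((k + 1 : ℕ) : ℝ) * (4 * M ^ 2) ≤ N * (4 * M ^ 2) := by gcongr
      linarith
    simp only [mem_biUnion, mem_univ, true_and, not_exists] at hx₀D
    obtain ⟨x, hxW, hxr⟩ := ih (by refine le_trans ?_ hk; push_cast; linarith)
      (fun i j => r i.succ j.succ) (fun i j => hr _ _)
      (fun j => {y ∈ W j.succ | r 0 j.succ x₀ y}) (fun j => by
        have := hx₀D j
        rw [mem_filter, not_and, not_lt] at this
        exact (hW' j.succ).trans (this hx₀))
    refine ⟨Fin.cons x₀ x, fun i => ?_, fun i j hij => ?_⟩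
    · refine Fin.cases ?_ (fun i => ?_) i
      · simpa using hx₀
      · simpa using (mem_filter.mp (hxW i)).1
    · obtain ⟨j, rfl⟩ := Fin.exists_succ_eq.mpr (Fin.ne_zero_of_lt hij)
      induction i using Fin.cases with
      | zero => simpa using (mem_filter.mp (hxW j)).2
      | succ i => simpa using hxr i j (by simpa using hij)

theorem exists_distance_embedding {K V : Type*} [Field K] [Fintype K] [AddCommGroup V] [Module K V]
    [Fintype V] (h2 : (2 : K) ≠ 0) {Q : QuadraticForm K V}
    (hQ : ∀ x, (∀ y, Q (x + y) - Q x - Q y = 0) → x = 0) (k : ℕ) (E : Finset V)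
    (hE : 6 * (k + 1) * √(Fintype.card K) * √(Fintype.card V) * (2 * Fintype.card K : ℝ) ^ k < #E)
    (c : Sym2 (Fin (k + 2)) → K) (hc : ∀ e, c e ≠ 0) :
    ∃ x : Fin (k + 2) → V, Function.Injective x ∧ (∀ i, x i ∈ E) ∧
      ∀ i j, i ≠ j → Q (x i - x j) = c s(i, j) := by
  have hq : (0 : ℝ) < Fintype.card K := by exact_mod_cast Fintype.card_pos
  have hq1 : (1 : ℝ) ≤ Fintype.card K := by exact_mod_cast Fintype.card_pos
  have hV : (0 : ℝ) < Fintype.card V := by exact_mod_cast Fintype.card_pos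
  set M := 3 * √(Fintype.card K) * √(Fintype.card V) with hM
  have hM0 : 0 < M := by positivity
  set μ : ℝ := #E / (2 * Fintype.card K) ^ k with hμ
  have hlt : 2 * (k + 1) * M < μ := by
    rw [hμ, lt_div_iff₀ (by positivity), hM]
    refine lt_of_eq_of_lt ?_ hE
    ring
  obtain ⟨x, hxE, hx⟩ := exists_embedding_of_mixing (q := Fintype.card K) (M := M) (μ := μ)
    (N := k + 1) hq (lt_trans (by positivity) hlt)
    (by
      have h1 : (2 * (k + 1) * M) ^ 2 < μ ^ 2 := pow_lt_pow_left₀ hlt (by positivity) two_ne_zero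
      have h3 : (k + 1 : ℝ) ≤ (k + 1) ^ 2 := le_self_pow₀ (by linarith [k.cast_nonneg (α := ℝ)]) two_ne_zero
      nlinarith [sq_nonneg M])
    (k + 1) (by push_cast; rfl) (fun i j x y => Q (x - y) = c s(i, j))
    (fun i j A B => abs_card_mul_pairCount_sub_le h2 hQ (hc _) A B)
    (by linarith) (fun _ => E) (fun _ => by rw [hμ, pow_succ]; field_simp; rfl)
  have hx' (i j) (hij : i ≠ j) : Q (x i - x j) = c s(i, j) := by
    rcases hij.lt_or_gt with h | h
    · exact hx i j h
    · rw [Sym2.eq_swap, ← hx j i h, ← QuadraticMap.map_neg, neg_sub]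
  refine ⟨x, fun i j hij => ?_, hxE, hx'⟩
  by_contra hne
  refine hc s(i, j) ?_
  rw [← hx' i j hne, hij, sub_self, QuadraticMap.map_zero]

/-- Kaleidoscopic property: Let `d ≥ 2` and `1 ≤ k - 1 ≤ n ≤ d`. There is
`C > 0` such that for every odd prime power `q`, every nondegenerate quadratic form `Q`
on `𝔽_q^d`, and every graph `H` on `{1, …, k}` with `n` edges whose edges are colored by
elements of `𝔽_q^*`, every set `E ⊆ 𝔽_q^d` with `|E| ≥ C q^((d-1)/2 + k - 1)` contains
a copy of the colored graph `H`: there are distinct `x₁, …, x_k ∈ E` with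
`Q (xᵢ - xⱼ) = c {i, j}` for every edge `{i, j}` of `H`. -/
theorem kaleidoscopic_property (d k n : ℕ) (hd : 2 ≤ d)
    (hk : 2 ≤ k) (hkn : k - 1 ≤ n) (hnd : n ≤ d) :
    ∃ C : ℝ, 0 < C ∧
      ∀ (q : ℕ), IsPrimePow q → Odd q →
      ∀ (K : Type) [Field K] [Fintype K], Fintype.card K = q →
      ∀ (Q : QuadraticForm K (Fin d → K)),
      (∀ x : Fin d → K, (∀ y : Fin d → K, Q (x + y) - Q x - Q y = 0) → x = 0) →
      ∀ (H : SimpleGraph (Fin k)), H.edgeFinset.card = n →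
      ∀ (c : Sym2 (Fin k) → K), (∀ e ∈ H.edgeSet, c e ≠ 0) →
      ∀ (E : Finset (Fin d → K)),
      C * (q : ℝ) ^ (((d : ℝ) - 1) / 2 + (k : ℝ) - 1) ≤ E.card →
      ∃ x : Fin k → (Fin d → K), Function.Injective x ∧ (∀ i, x i ∈ E) ∧
        ∀ i j, H.Adj i j → Q (x i - x j) = c s(i, j) := by
  obtain ⟨k, rfl⟩ := Nat.exists_eq_add_of_le' hk
  refine ⟨7 * (k + 1) * 2 ^ k, by positivity, ?_⟩
  intro q _ hodd K _ _ hK Q hQ H _ c hc E hE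
  have h2 : (2 : K) ≠ 0 := by
    refine Ring.two_ne_zero fun h => ?_
    have := (FiniteField.even_card_iff_char_two (F := K)).mp h
    rw [hK] at this
    exact Nat.not_even_iff_odd.mpr hodd (Nat.even_iff.mpr this)
  have hq : (0 : ℝ) < q := by rw [← hK]; exact_mod_cast Fintype.card_pos
  have hexp : (q : ℝ) ^ (((d : ℝ) - 1) / 2 + ((k + 2 : ℕ) : ℝ) - 1) = √q * √(q ^ d) * q ^ k := by
    rw [← Real.sqrt_mul hq.le, ← pow_succ', Real.sqrt_eq_rpow, ← Real.rpow_natCast,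
      ← Real.rpow_natCast, ← Real.rpow_mul hq.le, ← Real.rpow_add hq]
    congr 1
    push_cast
    ring
  obtain ⟨x, hinj, hxE, hx⟩ := exists_distance_embedding h2 hQ k E (by
    refine lt_of_lt_of_le ?_ hE
    rw [hexp, Fintype.card_fun, hK, Fintype.card_fin, mul_pow]
    push_cast
    have : (0 : ℝ) < (k + 1) * 2 ^ k * (√q * √(q ^ d) * q ^ k) := by positivity
    linarith) (fun e => if e ∈ H.edgeSet then c e else 1) (fun e => by
      split_ifs with he
      · exact hc e he
      · exact one_ne_zero)
  refine ⟨x, hinj, hxE, fun i j hij => ?_⟩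
  rw [hx i j hij.ne, if_pos ((SimpleGraph.mem_edgeSet H).mpr hij)]
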